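/- Let G be a simple graph of order n ≥ 5 with minimum degree δ(G) ≥ 2 and with no component isomorphic to C_5. Then γ_dR(G) ≤ ⌊13n/11⌋. -/

import Mathlib

/-- A double Roman dominating function on a simple graph `G`:
values in `{0,1,2,3}`, every vertex with value `0` has two neighbors with value `2`
or one neighbor with value `3`, and every vertex with value `1` has a neighbor with
value at least `2`. -/
def IsDRDF {V : Type*} (G : SimpleGraph V) (f : V → ℕ) : Prop :=
  (∀ v, f v ≤ 3) ∧
  (∀ v, f v = 0 →
    (∃ u w, u ≠ w ∧ G.Adj v u ∧ G.Adj v w ∧ f u = 2 ∧ f w = 2) ∨ ∃ u, G.Adj v u ∧ f u = 3) ∧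
  (∀ v, f v = 1 → ∃ u, G.Adj v u ∧ 2 ≤ f u)

/-- The double Roman domination number: the minimum weight of a DRDF. -/
noncomputable def gammaDR {V : Type*} [Fintype V] (G : SimpleGraph V) : ℕ :=
  sInf {w | ∃ f, IsDRDF G f ∧ ∑ v, f v = w}

/-- The cycle on `n` vertices (for `n ≥ 3`). -/
def cycleG (n : ℕ) : SimpleGraph (Fin n) :=
  SimpleGraph.fromRel (fun i j => (i.val + 1) % n = j.val)

section DRDHelpers
open Classical Finset

variable {V : Type} [Fintype V]

/-- Neighbour finset. -/
noncomputable def nb (H : SimpleGraph V) (x : V) : Finset V := univ.filter (fun y => H.Adj x y)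

theorem mem_nb {H : SimpleGraph V} {x y : V} : y ∈ nb H x ↔ H.Adj x y := by simp [nb]

/-- Sets closed under adjacency. -/
def ClosedS (H : SimpleGraph V) (S : Finset V) : Prop := ∀ x ∈ S, ∀ y, H.Adj x y → y ∈ S

/-- The local condition of a DRDF at a vertex. -/
def LocOK (H : SimpleGraph V) (f : V → ℕ) (v : V) : Prop :=
  f v ≤ 3 ∧ (f v = 0 → (∃ u w, u ≠ w ∧ H.Adj v u ∧ H.Adj v w ∧ f u = 2 ∧ f w = 2) ∨
    ∃ u, H.Adj v u ∧ f u = 3) ∧ (f v = 1 → ∃ u, H.Adj v u ∧ 2 ≤ f u)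

/-- A set which can be handled within budget. -/
def GoodS (H : SimpleGraph V) (S : Finset V) : Prop :=
  ∃ f : V → ℕ, (∀ v ∈ S, LocOK H f v) ∧ 11 * ∑ v ∈ S, f v ≤ 13 * S.card

theorem good_of_DR {H : SimpleGraph V} {S : Finset V} (D R : Finset V)
    (hdom : ∀ v ∈ S, v ∈ D ∨ v ∈ R ∨ ∃ u ∈ D, H.Adj v u)
    (hw : 11 * (3 * D.card + 2 * R.card) ≤ 13 * S.card) : GoodS H S := by
  refine ⟨fun v => if v ∈ D then 3 else if v ∈ R then 2 else 0, ?_, ?_⟩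
  · intro v hv
    refine ⟨?_, ?_, ?_⟩
    · dsimp only; split_ifs <;> omega
    · intro h0
      right
      rcases hdom v hv with h | h | ⟨u, hu, ha⟩
      · simp [h] at h0
      · by_cases h' : v ∈ D <;> simp [h, h'] at h0
      · exact ⟨u, ha, by simp [hu]⟩
    · intro h1
      exfalso
      dsimp only at h1
      split_ifs at h1 <;> omega
  · have h1 : ∑ v ∈ S, (if v ∈ D then 3 else if v ∈ R then 2 else 0)
        ≤ ∑ v ∈ S, ((if v ∈ D then 3 else 0) + (if v ∈ R then 2 else 0)) := by
      apply Finset.sum_le_sum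
      intro v _
      split_ifs <;> omega
    have h2 : ∑ v ∈ S, ((if v ∈ D then 3 else 0) + (if v ∈ R then 2 else 0))
        = 3 * (S.filter (· ∈ D)).card + 2 * (S.filter (· ∈ R)).card := by
      rw [Finset.sum_add_distrib, ← Finset.sum_filter, ← Finset.sum_filter]
      simp [mul_comm]
    have h3 : (S.filter (· ∈ D)).card ≤ D.card :=
      Finset.card_le_card (fun x hx => (Finset.mem_filter.1 hx).2)
    have h4 : (S.filter (· ∈ R)).card ≤ R.card :=
      Finset.card_le_card (fun x hx => (Finset.mem_filter.1 hx).2)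
    dsimp only
    omega

theorem good_glue {H : SimpleGraph V} {S T : Finset V} (hTS : T ⊆ S)
    (hT : ClosedS H T) (h1 : GoodS H T) (h2 : GoodS H (S \ T)) : GoodS H S := by
  obtain ⟨f, hf, hfw⟩ := h1
  obtain ⟨g, hg, hgw⟩ := h2
  refine ⟨fun v => if v ∈ T then f v else g v, ?_, ?_⟩
  · intro v hv
    by_cases hvT : v ∈ T
    · obtain ⟨a, b, c⟩ := hf v hvT
      have key : ∀ u, H.Adj v u → u ∈ T := fun u hu => hT v hvT u hu
      refine ⟨by simpa [hvT] using a, ?_, ?_⟩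
      · intro h0
        rcases b (by simpa [hvT] using h0) with ⟨u, w, h1, h2, h3, h4, h5⟩ | ⟨u, h1, h2⟩
        · exact Or.inl ⟨u, w, h1, h2, h3, by simpa [key u h2] using h4,
            by simpa [key w h3] using h5⟩
        · exact Or.inr ⟨u, h1, by simpa [key u h1] using h2⟩
      · intro h0
        obtain ⟨u, h1, h2⟩ := c (by simpa [hvT] using h0)
        exact ⟨u, h1, by simpa [key u h1] using h2⟩
    · obtain ⟨a, b, c⟩ := hg v (Finset.mem_sdiff.2 ⟨hv, hvT⟩)
      have key : ∀ u, H.Adj v u → u ∉ T := fun u hu h => hvT (hT u h v hu.symm)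
      refine ⟨by simpa [hvT] using a, ?_, ?_⟩
      · intro h0
        rcases b (by simpa [hvT] using h0) with ⟨u, w, h1, h2, h3, h4, h5⟩ | ⟨u, h1, h2⟩
        · exact Or.inl ⟨u, w, h1, h2, h3, by simpa [key u h2] using h4,
            by simpa [key w h3] using h5⟩
        · exact Or.inr ⟨u, h1, by simpa [key u h1] using h2⟩
      · intro h0
        obtain ⟨u, h1, h2⟩ := c (by simpa [hvT] using h0)
        exact ⟨u, h1, by simpa [key u h1] using h2⟩
  · have e1 : ∑ v ∈ S, (if v ∈ T then f v else g v)
        = ∑ v ∈ S \ T, g v + ∑ v ∈ T, f v := by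
      rw [← Finset.sum_sdiff hTS]
      congr 1
      · apply Finset.sum_congr rfl
        intro v hv
        simp [(Finset.mem_sdiff.1 hv).2]
      · apply Finset.sum_congr rfl
        intro v hv
        simp [hv]
    have e2 := Finset.card_sdiff_add_card_eq_card hTS
    simp only [e1]
    omega

/-- A maximal independent subset for a relation. -/
theorem exists_max_indep (r : V → V → Prop) (hr : ∀ a b, r a b → r b a) (P : Finset V) :
    ∃ A ⊆ P, (∀ a ∈ A, ∀ b ∈ A, a ≠ b → ¬ r a b) ∧ ∀ p ∈ P, p ∈ A ∨ ∃ a ∈ A, r a p := by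
  induction P using Finset.induction_on with
  | empty => exact ⟨∅, by simp⟩
  | insert p P hp ih =>
    obtain ⟨A, hA, h1, h2⟩ := ih
    by_cases h : ∃ a ∈ A, r a p
    · refine ⟨A, hA.trans (Finset.subset_insert _ _), h1, ?_⟩
      intro q hq
      rcases Finset.mem_insert.1 hq with rfl | hq
      · exact Or.inr h
      · exact h2 q hq
    · push Not at h
      refine ⟨insert p A, Finset.insert_subset_insert _ hA, ?_, ?_⟩
      · intro a ha b hb hab
        rcases Finset.mem_insert.1 ha with ha' | ha' <;> rcases Finset.mem_insert.1 hb with hb' | hb'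
        · exact absurd (ha'.trans hb'.symm) hab
        · subst ha'; exact fun hh => h b hb' (hr _ _ hh)
        · subst hb'; exact h a ha'
        · exact h1 a ha' b hb' hab
      · intro q hq
        rcases Finset.mem_insert.1 hq with rfl | hq
        · simp
        · rcases h2 q hq with h3 | ⟨a, ha, h3⟩
          · exact Or.inl (Finset.mem_insert_of_mem h3)
          · exact Or.inr ⟨a, Finset.mem_insert_of_mem ha, h3⟩

/-- Sum of inner degrees. -/
noncomputable def phi (H : SimpleGraph V) (S : Finset V) : ℕ := ∑ x ∈ S, (nb H x ∩ S).card

theorem card_nb_erase {H : SimpleGraph V} {S : Finset V} {p : V} (hp : p ∈ S) (x : V) :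
    (nb H x ∩ S).card = (nb H x ∩ S.erase p).card + if H.Adj x p then 1 else 0 := by
  rw [Finset.inter_erase]
  split_ifs with h
  · exact (Finset.card_erase_add_one (Finset.mem_inter.2 ⟨mem_nb.2 h, hp⟩)).symm
  · rw [Finset.erase_eq_of_notMem (fun hh => h (mem_nb.1 (Finset.mem_inter.1 hh).1)), add_zero]

theorem phi_erase {H : SimpleGraph V} {S : Finset V} {p : V} (hp : p ∈ S) :
    phi H S = phi H (S.erase p) + 2 * (nb H p ∩ S).card := by
  unfold phi
  rw [← Finset.add_sum_erase S _ hp]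
  rw [Finset.sum_congr rfl (fun x _ => card_nb_erase (H := H) hp x), Finset.sum_add_distrib,
    ← Finset.sum_filter]
  have : (S.erase p).filter (fun x => H.Adj x p) = nb H p ∩ S := by
    ext x
    simp only [Finset.mem_filter, Finset.mem_erase, Finset.mem_inter, mem_nb]
    constructor
    · rintro ⟨⟨_, h2⟩, h3⟩; exact ⟨h3.symm, h2⟩
    · rintro ⟨h3, h2⟩; exact ⟨⟨h3.ne', h2⟩, h3.symm⟩
  rw [this]
  simp
  omega

theorem path_lemma (H : SimpleGraph V) : ∀ (n : ℕ) (S : Finset V), S.card = n →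
    (∀ x ∈ S, (nb H x ∩ S).card ≤ 2) →
    (∀ T ⊆ S, T.Nonempty → ∃ x ∈ T, (nb H x ∩ T).card ≤ 1) →
    ∃ D R : Finset V, (∀ x ∈ S, (nb H x ∩ S).card = 2 →
      x ∈ D ∨ x ∈ R ∨ ∃ y ∈ D, H.Adj x y) ∧ 6 * D.card + 4 * R.card ≤ phi H S := by
  intro n
  induction n using Nat.strong_induction_on with
  | _ n ih =>
  intro S hSn h2 hac
  by_cases hne : S.Nonempty
  swap
  · rw [Finset.not_nonempty_iff_eq_empty] at hne
    subst hne
    exact ⟨∅, ∅, by simp, by simp⟩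
  obtain ⟨p1, hp1, hd1⟩ := hac S (Finset.Subset.refl _) hne
  have sub : ∀ T ⊂ S, ∃ D R : Finset V, (∀ x ∈ T, (nb H x ∩ T).card = 2 →
      x ∈ D ∨ x ∈ R ∨ ∃ y ∈ D, H.Adj x y) ∧ 6 * D.card + 4 * R.card ≤ phi H T := by
    intro T hT
    refine ih T.card (hSn ▸ Finset.card_lt_card hT) T rfl ?_ ?_
    · intro x hx
      exact (Finset.card_le_card (Finset.inter_subset_inter_left hT.1)).trans (h2 x (hT.1 hx))
    · intro T' hT'
      exact hac T' (hT'.trans hT.1)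
  by_cases hA : ∀ x ∈ nb H p1 ∩ S, (nb H x ∩ S).card ≤ 1
  · obtain ⟨D, R, hdom, hw⟩ := sub (S.erase p1) (Finset.erase_ssubset hp1)
    refine ⟨D, R, ?_, ?_⟩
    · intro x hx hx2
      have hxp : x ≠ p1 := by rintro rfl; omega
      have hna : ¬ H.Adj x p1 := by
        intro ha
        have := hA x (Finset.mem_inter.2 ⟨mem_nb.2 ha.symm, hx⟩)
        omega
      have := card_nb_erase (H := H) hp1 x
      rw [if_neg hna] at this
      exact hdom x (Finset.mem_erase.2 ⟨hxp, hx⟩) (by omega)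
    · have := phi_erase (H := H) hp1
      omega
  push Not at hA
  obtain ⟨p2, hp2, hd2⟩ := hA
  have hp2S : p2 ∈ S := (Finset.mem_inter.1 hp2).2
  have a12 : H.Adj p1 p2 := mem_nb.1 (Finset.mem_inter.1 hp2).1
  have hd2' : (nb H p2 ∩ S).card = 2 := by have := h2 p2 hp2S; omega
  have hN1 : ∀ z ∈ S, H.Adj p1 z → z = p2 := fun z hz ha =>
    Finset.card_le_one.1 hd1 z (Finset.mem_inter.2 ⟨mem_nb.2 ha, hz⟩) p2 hp2
  have hp1m : p1 ∈ nb H p2 ∩ S := Finset.mem_inter.2 ⟨mem_nb.2 a12.symm, hp1⟩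
  have hc1 : ((nb H p2 ∩ S).erase p1).card = 1 := by
    rw [Finset.card_erase_of_mem hp1m, hd2']
  obtain ⟨p3, hp3⟩ := Finset.card_eq_one.1 hc1
  have hp3m : p3 ∈ (nb H p2 ∩ S).erase p1 := by rw [hp3]; simp
  obtain ⟨h31, hp3m'⟩ := Finset.mem_erase.1 hp3m
  have hp3S : p3 ∈ S := (Finset.mem_inter.1 hp3m').2
  have a23 : H.Adj p2 p3 := mem_nb.1 (Finset.mem_inter.1 hp3m').1
  have hN2 : ∀ z ∈ S, H.Adj p2 z → z = p1 ∨ z = p3 := by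
    intro z hz ha
    by_cases h : z = p1
    · exact Or.inl h
    · right
      have : z ∈ (nb H p2 ∩ S).erase p1 :=
        Finset.mem_erase.2 ⟨h, Finset.mem_inter.2 ⟨mem_nb.2 ha, hz⟩⟩
      rw [hp3] at this
      simpa using this
  have h12 : p1 ≠ p2 := a12.ne
  have h23 : p2 ≠ p3 := a23.ne
  have na13 : ¬ H.Adj p1 p3 := fun h => h23 (hN1 p3 hp3S h).symm
  have m2 : p2 ∈ S.erase p1 := Finset.mem_erase.2 ⟨h12.symm, hp2S⟩
  have m3 : p3 ∈ (S.erase p1).erase p2 :=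
    Finset.mem_erase.2 ⟨h23.symm, Finset.mem_erase.2 ⟨h31, hp3S⟩⟩
  have e1 := phi_erase (H := H) hp1
  have e2 := phi_erase (H := H) m2
  have e3 := phi_erase (H := H) m3
  have c2 := card_nb_erase (H := H) hp1 p2
  rw [if_pos a12.symm] at c2
  have c3 := card_nb_erase (H := H) hp1 p3
  rw [if_neg (fun h => na13 h.symm)] at c3
  have c3' := card_nb_erase (H := H) m2 p3
  rw [if_pos a23.symm] at c3'
  have c1 : 1 ≤ (nb H p1 ∩ S).card := Finset.card_pos.2 ⟨p2, hp2⟩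
  have hss : ((S.erase p1).erase p2).erase p3 ⊂ S :=
    ((Finset.erase_subset _ _).trans (Finset.erase_subset _ _)).trans_ssubset
      (Finset.erase_ssubset hp1)
  obtain ⟨D, R, hdom, hw⟩ := sub _ hss
  have hd3 := h2 p3 hp3S
  have inner : ∀ x ∈ S, x ≠ p1 → x ≠ p2 → x ≠ p3 → ¬ H.Adj x p3 → (nb H x ∩ S).card = 2 →
      x ∈ D ∨ x ∈ R ∨ ∃ y ∈ D, H.Adj x y := by
    intro x hx n1 n2 n3 na hx2
    apply hdom x
    · simp [n1, n2, n3, hx]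
    · have t1 := card_nb_erase (H := H) hp1 x
      rw [if_neg (fun h => n2 (hN1 x hx h.symm))] at t1
      have t2 := card_nb_erase (H := H) m2 x
      rw [if_neg (fun h => (hN2 x hx h.symm).elim n1 n3)] at t2
      have t3 := card_nb_erase (H := H) m3 x
      rw [if_neg na] at t3
      omega
  by_cases h3 : (nb H p3 ∩ S).card = 2
  · refine ⟨insert p3 D, R, ?_, ?_⟩
    · intro x hx hx2
      by_cases n1 : x = p1
      · subst n1; omega
      by_cases n2 : x = p2
      · subst n2; exact Or.inr (Or.inr ⟨p3, by simp, a23⟩)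
      by_cases n3 : x = p3
      · subst n3; exact Or.inl (by simp)
      by_cases na : H.Adj x p3
      · exact Or.inr (Or.inr ⟨p3, by simp, na⟩)
      rcases inner x hx n1 n2 n3 na hx2 with h | h | ⟨y, h, h'⟩
      · exact Or.inl (by simp [h])
      · exact Or.inr (Or.inl h)
      · exact Or.inr (Or.inr ⟨y, by simp [h], h'⟩)
    · have := Finset.card_insert_le p3 D
      omega
  · refine ⟨D, insert p2 R, ?_, ?_⟩
    · intro x hx hx2
      by_cases n1 : x = p1
      · subst n1; omega
      by_cases n2 : x = p2
      · subst n2; exact Or.inr (Or.inl (by simp))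
      by_cases n3 : x = p3
      · subst n3; omega
      have na : ¬ H.Adj x p3 := by
        intro na
        have l1 : (nb H p3 ∩ S).card ≤ 1 := by omega
        exact n2 (Finset.card_le_one.1 l1 x (Finset.mem_inter.2 ⟨mem_nb.2 na.symm, hx⟩) p2
          (Finset.mem_inter.2 ⟨mem_nb.2 a23.symm, hp2S⟩))
      rcases inner x hx n1 n2 n3 na hx2 with h | h | ⟨y, h, h'⟩
      · exact Or.inl h
      · exact Or.inr (Or.inl (by simp [h]))
      · exact Or.inr (Or.inr ⟨y, h, h'⟩)
    · have := Finset.card_insert_le p2 R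
      omega

/-- `Q` is a 5-set inducing a 5-cycle through `a` once the edge `a y` is deleted. -/
def Pend (H : SimpleGraph V) (Q : Finset V) (a y : V) : Prop :=
  Q.card = 5 ∧ a ∈ Q ∧ H.Adj a y ∧ (∀ x ∈ Q, ∀ z, H.Adj x z → z ∈ Q ∨ (x = a ∧ z = y)) ∧
  (∀ x ∈ Q, x ≠ a → x ≠ y → (nb H x).card = 2) ∧ (nb H a).card = 3 ∧ 3 ≤ (nb H y).card

/-- Edge-minimal graphs. -/
structure MinG (H : SimpleGraph V) : Prop where
  mindeg : ∀ x, 2 ≤ (nb H x).card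
  noC5 : ∀ S : Finset V, S.card = 5 → ClosedS H S → ∃ x ∈ S, (nb H x).card ≠ 2
  edge : ∀ u v, H.Adj u v → 3 ≤ (nb H u).card → 3 ≤ (nb H v).card →
    ∃ Q, Pend H Q u v ∨ Pend H Q v u

/-- No proper nonempty closed subsets. -/
def Irred (H : SimpleGraph V) (S : Finset V) : Prop :=
  ∀ T ⊆ S, T.Nonempty → ClosedS H T → T = S

theorem closed_of_two {H : SimpleGraph V} {T : Finset V} (h2 : ∀ x ∈ T, (nb H x).card = 2)
    (h : ∀ x ∈ T, 1 < (nb H x ∩ T).card) : ClosedS H T := by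
  intro x hx y hy
  have e : nb H x ∩ T = nb H x :=
    Finset.eq_of_subset_of_card_le Finset.inter_subset_left (by rw [h2 x hx]; exact h x hx)
  have : y ∈ nb H x ∩ T := by rw [e]; exact mem_nb.2 hy
  exact (Finset.mem_inter.1 this).2

theorem good_cycle {H : SimpleGraph V} (hM : MinG H) {S : Finset V} (hS : ClosedS H S)
    (hI : Irred H S) (hne : S.Nonempty) (h2 : ∀ x ∈ S, (nb H x).card = 2) : GoodS H S := by
  obtain ⟨r, hr⟩ := hne
  have nbS : ∀ x ∈ S, nb H x ⊆ S := fun x hx y hy => hS x hx y (mem_nb.1 hy)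
  have hrn : r ∉ nb H r := fun h => H.loopless.irrefl r (mem_nb.1 h)
  have hcl : (insert r (nb H r)).card = 3 := by rw [Finset.card_insert_of_notMem hrn, h2 r hr]
  have hsub : insert r (nb H r) ⊆ S := Finset.insert_subset hr (nbS r hr)
  have hge : 3 ≤ S.card := hcl ▸ Finset.card_le_card hsub
  have hne5 : S.card ≠ 5 := by
    intro h5
    obtain ⟨x, hx, hx2⟩ := hM.noC5 S h5 hS
    exact hx2 (h2 x hx)
  by_cases h3 : S.card = 3
  · have e : insert r (nb H r) = S := Finset.eq_of_subset_of_card_le hsub (by omega)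
    refine good_of_DR {r} ∅ ?_ (by simp; omega)
    intro v hv
    rw [← e] at hv
    rcases Finset.mem_insert.1 hv with h | h
    · exact Or.inl (by simp [h])
    · exact Or.inr (Or.inr ⟨r, by simp, (mem_nb.1 h).symm⟩)
  by_cases h4 : S.card = 4
  · have hc : (S \ insert r (nb H r)).card = 1 := by
      have := Finset.card_sdiff_add_card_eq_card hsub
      omega
    obtain ⟨c, hc⟩ := Finset.card_eq_one.1 hc
    have hcm : c ∈ S \ insert r (nb H r) := by rw [hc]; simp
    obtain ⟨hcS, hcn⟩ := Finset.mem_sdiff.1 hcm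
    have hcr : c ≠ r := fun h => hcn (by simp [h])
    have hcr' : c ∉ nb H r := fun h => hcn (by simp [h])
    have hcov : ∀ v ∈ S, v = r ∨ v ∈ nb H r ∨ v = c := by
      intro v hv
      by_cases h : v ∈ insert r (nb H r)
      · rcases Finset.mem_insert.1 h with h | h
        · exact Or.inl h
        · exact Or.inr (Or.inl h)
      · have : v ∈ S \ insert r (nb H r) := Finset.mem_sdiff.2 ⟨hv, h⟩
        rw [hc] at this
        exact Or.inr (Or.inr (by simpa using this))
    have hnc : nb H c = nb H r := by
      apply Finset.eq_of_subset_of_card_le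
      · intro z hz
        rcases hcov z (nbS c hcS hz) with h | h | h
        · subst h
          exact absurd (mem_nb.2 (mem_nb.1 hz).symm) hcr'
        · exact h
        · subst h
          exact absurd (mem_nb.1 hz) (H.loopless.irrefl z)
      · rw [h2 r hr, h2 c hcS]
    refine ⟨fun v => if v = r ∨ v = c then 2 else 0, ?_, ?_⟩
    · intro v hv
      refine ⟨by dsimp only; split_ifs <;> omega, ?_, ?_⟩
      · intro h0
        left
        rcases hcov v hv with h | h | h
        · simp [h] at h0
        · exact ⟨r, c, hcr.symm, (mem_nb.1 h).symm, (mem_nb.1 (hnc ▸ h)).symm, by simp, by simp⟩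
        · simp [h] at h0
      · intro h1
        exfalso
        dsimp only at h1
        split_ifs at h1 <;> omega
    · have : ∑ v ∈ S, (if v = r ∨ v = c then 2 else 0) ≤ 4 := by
        rw [← Finset.sum_filter]
        have : (S.filter (fun v => v = r ∨ v = c)).card ≤ 2 := by
          refine (Finset.card_le_card (t := {r, c}) ?_).trans Finset.card_le_two
          intro x hx
          simpa using (Finset.mem_filter.1 hx).2
        simp
        omega
      dsimp only
      omega
  have h6 : 6 ≤ S.card := by omega
  obtain ⟨D, R, hdom, hw⟩ := path_lemma H _ (S.erase r) rfl
    (fun x hx => (Finset.card_le_card Finset.inter_subset_left).trans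
      (h2 x (Finset.mem_of_mem_erase hx)).le) (by
      intro T hT hTne
      by_contra hcon
      push Not at hcon
      have hTS := hT.trans (Finset.erase_subset _ _)
      have := hI T hTS hTne (closed_of_two (fun x hx => h2 x (hTS hx)) hcon)
      rw [this] at hT
      exact absurd (hT hr) (by simp))
  have hphi : phi H S = 2 * S.card := by
    unfold phi
    rw [Finset.sum_congr rfl (fun x hx => by
      rw [Finset.inter_eq_left.2 (nbS x hx), h2 x hx] : ∀ x ∈ S, (nb H x ∩ S).card = 2)]
    simp [mul_comm]
  have he := phi_erase (H := H) hr
  rw [Finset.inter_eq_left.2 (nbS r hr), h2 r hr] at he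
  refine good_of_DR (insert r D) R ?_ ?_
  · intro v hv
    by_cases hvr : v = r
    · exact Or.inl (by simp [hvr])
    by_cases ha : H.Adj v r
    · exact Or.inr (Or.inr ⟨r, by simp, ha⟩)
    have t := card_nb_erase (H := H) hr v
    rw [if_neg ha, Finset.inter_eq_left.2 (nbS v hv), h2 v hv] at t
    rcases hdom v (Finset.mem_erase.2 ⟨hvr, hv⟩) (by omega) with h | h | ⟨y, h, h'⟩
    · exact Or.inl (by simp [h])
    · exact Or.inr (Or.inl h)
    · exact Or.inr (Or.inr ⟨y, by simp [h], h'⟩)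
  · have := Finset.card_insert_le r D
    omega

theorem good_small {H : SimpleGraph V} {S : Finset V} (hS : ClosedS H S) {a : V} (ha : a ∈ S)
    (h3 : 3 ≤ (nb H a).card) (h6 : S.card ≤ 6) : GoodS H S := by
  have hrn : a ∉ nb H a := fun h => H.loopless.irrefl a (mem_nb.1 h)
  have hcl := Finset.card_insert_of_notMem hrn
  have hsub : insert a (nb H a) ⊆ S :=
    Finset.insert_subset ha (fun y hy => hS a ha y (mem_nb.1 hy))
  have := Finset.card_sdiff_add_card_eq_card hsub
  refine good_of_DR {a} (S \ insert a (nb H a)) ?_ ?_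
  · intro v hv
    by_cases h : v ∈ insert a (nb H a)
    · rcases Finset.mem_insert.1 h with h | h
      · exact Or.inl (by simp [h])
      · exact Or.inr (Or.inr ⟨a, by simp, (mem_nb.1 h).symm⟩)
    · exact Or.inr (Or.inl (Finset.mem_sdiff.2 ⟨hv, h⟩))
  · rw [Finset.card_singleton]
    omega

theorem pend_dom {H : SimpleGraph V} {Q : Finset V} {a y : V} (hP : Pend H Q a y) (hy : y ∉ Q) :
    ∃ d e, ∀ v ∈ Q, v = a ∨ v = d ∨ v = e ∨ H.Adj v d := by
  obtain ⟨h5, haQ, hay, hcl, hd2, hda, -⟩ := hP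
  have hN : (insert a ((nb H a).erase y)).card ≤ 3 := by
    refine (Finset.card_insert_le _ _).trans ?_
    rw [Finset.card_erase_of_mem (mem_nb.2 hay), hda]
  obtain ⟨d, hdQ, hdn⟩ := Finset.exists_mem_notMem_of_card_lt_card
    (show (insert a ((nb H a).erase y)).card < Q.card by omega)
  have hda' : d ≠ a := fun h => hdn (by simp [h])
  have hdy : d ≠ y := fun h => hy (h ▸ hdQ)
  have hnad : ¬ H.Adj a d := fun h => hdn (by simp [hdy, mem_nb, h])
  have hd := hd2 d hdQ hda' hdy
  have c1 : d ∉ nb H d := fun h => H.loopless.irrefl d (mem_nb.1 h)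
  have c2 : a ∉ insert d (nb H d) := by
    simp [mem_nb, hda'.symm]
    exact fun h => hnad h.symm
  have hc : (insert a (insert d (nb H d))).card = 4 := by
    rw [Finset.card_insert_of_notMem c2, Finset.card_insert_of_notMem c1, hd]
  have hsub : insert a (insert d (nb H d)) ⊆ Q := by
    refine Finset.insert_subset haQ (Finset.insert_subset hdQ ?_)
    intro z hz
    rcases hcl d hdQ z (mem_nb.1 hz) with h | h
    · exact h
    · exact absurd h.1 hda'
  have hcc := Finset.card_sdiff_add_card_eq_card hsub
  obtain ⟨e, he⟩ := Finset.card_eq_one.1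
    (show (Q \ insert a (insert d (nb H d))).card = 1 by omega)
  refine ⟨d, e, fun v hv => ?_⟩
  by_cases h : v ∈ insert a (insert d (nb H d))
  · simp only [Finset.mem_insert, mem_nb] at h
    rcases h with h | h | h
    · exact Or.inl h
    · exact Or.inr (Or.inl h)
    · exact Or.inr (Or.inr (Or.inr h.symm))
  · have : v ∈ Q \ insert a (insert d (nb H d)) := Finset.mem_sdiff.2 ⟨hv, h⟩
    rw [he] at this
    exact Or.inr (Or.inr (Or.inl (by simpa using this)))

theorem pend_sub {H : SimpleGraph V} (hM : MinG H) {S : Finset V} (hS : ClosedS H S)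
    {Q : Finset V} {a y : V} (hP : Pend H Q a y) (ha : a ∈ S) : Q ⊆ S := by
  obtain ⟨h5, haQ, hay, hcl, hd2, hda, -⟩ := hP
  intro x hx
  by_contra hxS
  have c1 : x ∉ nb H x := fun h => H.loopless.irrefl x (mem_nb.1 h)
  have s1 : insert x (nb H x) ⊆ Q \ S := by
    refine Finset.insert_subset (Finset.mem_sdiff.2 ⟨hx, hxS⟩) ?_
    intro z hz
    have hz := mem_nb.1 hz
    refine Finset.mem_sdiff.2 ⟨?_, fun h => hxS (hS z h x hz.symm)⟩
    rcases hcl x hx z hz with h | h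
    · exact h
    · exact absurd (h.1 ▸ ha) hxS
  have k1 := Finset.card_le_card s1
  rw [Finset.card_insert_of_notMem c1] at k1
  have c2 : a ∉ (nb H a).erase y := fun h =>
    H.loopless.irrefl a (mem_nb.1 (Finset.mem_of_mem_erase h))
  have s2 : insert a ((nb H a).erase y) ⊆ Q ∩ S := by
    refine Finset.insert_subset (Finset.mem_inter.2 ⟨haQ, ha⟩) ?_
    intro z hz
    obtain ⟨hzy, hz⟩ := Finset.mem_erase.1 hz
    have hz := mem_nb.1 hz
    refine Finset.mem_inter.2 ⟨?_, hS a ha z hz⟩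
    rcases hcl a haQ z hz with h | h
    · exact h
    · exact absurd h.2 hzy
  have k2 := Finset.card_le_card s2
  rw [Finset.card_insert_of_notMem c2, Finset.card_erase_of_mem (mem_nb.2 hay), hda] at k2
  have k3 := Finset.card_sdiff_add_card_inter Q S
  have := hM.mindeg x
  omega

theorem good_main {H : SimpleGraph V} (hM : MinG H) {S : Finset V} (hS : ClosedS H S)
    (hI : Irred H S) (hbig : ∃ x ∈ S, 3 ≤ (nb H x).card) : GoodS H S := by
  by_cases hchord : ∃ Q a y, Pend H Q a y ∧ y ∈ Q ∧ a ∈ S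
  · obtain ⟨Q, a, y, hP, hyQ, haS⟩ := hchord
    have hQcl : ClosedS H Q := by
      intro x hx z hz
      rcases hP.2.2.2.1 x hx z hz with h | h
      · exact h
      · exact h.2 ▸ hyQ
    have he := hI Q (pend_sub hM hS hP haS) ⟨a, hP.2.1⟩ hQcl
    refine good_small hS haS hP.2.2.2.2.2.1.ge ?_
    rw [← he, hP.1]
    omega
  push Not at hchord
  have nch : ∀ Q a y, Pend H Q a y → a ∈ S → y ∉ Q := fun Q a y h1 h2 h3 => hchord Q a y h1 h3 h2
  -- attachment vertices
  obtain ⟨A, hAP, hAind, hAmax⟩ := exists_max_indep H.Adj (fun _ _ h => h.symm)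
    (S.filter (fun a => ∃ Q y, Pend H Q a y))
  have hAS : ∀ a ∈ A, a ∈ S := fun a ha => (Finset.mem_filter.1 (hAP ha)).1
  have hex : ∀ a, ∃ Q y, a ∈ A → Pend H Q a y := by
    intro a
    by_cases ha : a ∈ A
    · obtain ⟨Q, y, h⟩ := (Finset.mem_filter.1 (hAP ha)).2
      exact ⟨Q, y, fun _ => h⟩
    · exact ⟨∅, a, fun h => absurd h ha⟩
  choose Q y hP using hex
  have hyQ : ∀ a ∈ A, y a ∉ Q a := fun a ha => nch _ _ _ (hP a ha) (hAS a ha)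
  have hex2 : ∀ a, ∃ d e, a ∈ A → ∀ v ∈ Q a, v = a ∨ v = d ∨ v = e ∨ H.Adj v d := by
    intro a
    by_cases ha : a ∈ A
    · obtain ⟨d, e, h⟩ := pend_dom (hP a ha) (hyQ a ha)
      exact ⟨d, e, fun _ => h⟩
    · exact ⟨a, a, fun h => absurd h ha⟩
  choose dd ee hde using hex2
  have hA3 : ∀ a ∈ A, (nb H a).card = 3 := fun a ha => (hP a ha).2.2.2.2.2.1
  have haQ : ∀ a ∈ A, a ∈ Q a := fun a ha => (hP a ha).2.1
  have hay : ∀ a ∈ A, H.Adj a (y a) := fun a ha => (hP a ha).2.2.1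
  have hQcl : ∀ a ∈ A, ∀ x ∈ Q a, ∀ z, H.Adj x z → z ∈ Q a ∨ (x = a ∧ z = y a) :=
    fun a ha => (hP a ha).2.2.2.1
  have hQ2 : ∀ a ∈ A, ∀ x ∈ Q a, x ≠ a → (nb H x).card = 2 := fun a ha x hx hxa =>
    (hP a ha).2.2.2.2.1 x hx hxa (fun h => hyQ a ha (h ▸ hx))
  have hy3 : ∀ a ∈ A, 3 ≤ (nb H (y a)).card := fun a ha => (hP a ha).2.2.2.2.2.2
  have hyS : ∀ a ∈ A, y a ∈ S := fun a ha => hS a (hAS a ha) _ (hay a ha)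
  have hyA : ∀ a ∈ A, y a ∉ A := fun a ha h => hAind a ha _ h (hay a ha).ne (hay a ha)
  have hQS : ∀ a ∈ A, Q a ⊆ S := fun a ha => pend_sub hM hS (hP a ha) (hAS a ha)
  -- big-big edges
  have half : ∀ Q' a b, Pend H Q' a b → a ∈ S → a ∈ A ∨ b ∈ A := by
    intro Q' a b hp ha
    rcases hAmax a (Finset.mem_filter.2 ⟨ha, Q', b, hp⟩) with h | ⟨a', ha', h⟩
    · exact Or.inl h
    · right
      have hb := nch _ _ _ hp ha
      rcases hp.2.2.2.1 a hp.2.1 a' h.symm with h' | h'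
      · have := hp.2.2.2.2.1 a' h' h.ne (fun hh => hb (hh ▸ h'))
        have := hA3 a' ha'
        omega
      · exact h'.2 ▸ ha'
  have bigedge : ∀ u v, u ∈ S → H.Adj u v → 3 ≤ (nb H u).card → 3 ≤ (nb H v).card →
      u ∈ A ∨ v ∈ A := by
    intro u v hu huv h1 h2
    obtain ⟨Q', hp | hp⟩ := hM.edge u v huv h1 h2
    · exact half _ _ _ hp hu
    · exact (half _ _ _ hp (hS u hu v huv)).symm
  obtain ⟨U, hUdef⟩ : ∃ U, U = A.biUnion Q := ⟨_, rfl⟩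
  obtain ⟨B, hBdef⟩ : ∃ B, B = S.filter (fun x => 3 ≤ (nb H x).card ∧ x ∉ A) := ⟨_, rfl⟩
  obtain ⟨W, hWdef⟩ : ∃ W, W = S.filter (fun x => (nb H x).card = 2 ∧ x ∉ U) := ⟨_, rfl⟩
  have mU : ∀ x, x ∈ U ↔ ∃ a ∈ A, x ∈ Q a := by intro x; rw [hUdef]; simp
  have mB : ∀ x, x ∈ B ↔ x ∈ S ∧ 3 ≤ (nb H x).card ∧ x ∉ A := by intro x; rw [hBdef]; simp
  have mW : ∀ x, x ∈ W ↔ x ∈ S ∧ (nb H x).card = 2 ∧ x ∉ U := by intro x; rw [hWdef]; simp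
  have hyB : ∀ a ∈ A, y a ∈ B := fun a ha => (mB _).2 ⟨hyS a ha, hy3 a ha, hyA a ha⟩
  have BU : ∀ b ∈ B, b ∉ U := by
    intro b hb hU
    obtain ⟨a, ha, hbQ⟩ := (mU b).1 hU
    obtain ⟨_, h3, hA⟩ := (mB b).1 hb
    have := hQ2 a ha b hbQ (fun h => hA (h ▸ ha))
    omega
  have nB : ∀ b ∈ B, ∀ z, H.Adj b z → z ∈ W ∨ z ∈ A := by
    intro b hb z hz
    obtain ⟨hbS, h3, hA⟩ := (mB b).1 hb
    by_cases hz3 : 3 ≤ (nb H z).card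
    · exact Or.inr ((bigedge b z hbS hz h3 hz3).resolve_left hA)
    · left
      have := hM.mindeg z
      refine (mW z).2 ⟨hS b hbS z hz, by omega, ?_⟩
      intro hU
      obtain ⟨a, ha, hzQ⟩ := (mU z).1 hU
      rcases hQcl a ha z hzQ b hz.symm with h | h
      · exact BU b hb ((mU b).2 ⟨a, ha, h⟩)
      · have := hA3 a ha
        rw [← h.1] at this
        omega
  have nW : ∀ w ∈ W, ∀ z, H.Adj w z → z ∈ B ∨ z ∈ W := by
    intro w hw z hz
    obtain ⟨hwS, hw2, hwU⟩ := (mW w).1 hw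
    have hzS := hS w hwS z hz
    by_cases hz3 : 3 ≤ (nb H z).card
    · left
      refine (mB z).2 ⟨hzS, hz3, ?_⟩
      intro hzA
      rcases hQcl z hzA z (haQ z hzA) w hz.symm with h | h
      · exact hwU ((mU w).2 ⟨z, hzA, h⟩)
      · have := hy3 z hzA
        rw [← h.2] at this
        omega
    · right
      have := hM.mindeg z
      refine (mW z).2 ⟨hzS, by omega, ?_⟩
      intro hU
      obtain ⟨a, ha, hzQ⟩ := (mU z).1 hU
      rcases hQcl a ha z hzQ w hz.symm with h | h
      · exact hwU ((mU w).2 ⟨a, ha, h⟩)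
      · have := hA3 a ha
        rw [← h.1] at this
        omega
  have BW : ∀ x, x ∈ B → x ∉ W := by
    intro x hb hw
    have := ((mB x).1 hb).2.1
    have := ((mW x).1 hw).2.1
    omega
  have AW : ∀ x, x ∈ A → x ∉ W := by
    intro x hb hw
    have := hA3 x hb
    have := ((mW x).1 hw).2.1
    omega
  -- the path forest
  obtain ⟨x0, hx0S, hx0⟩ := hbig
  obtain ⟨DW, RW, hdomW, hwW⟩ := path_lemma H _ W rfl
    (fun x hx => (Finset.card_le_card Finset.inter_subset_left).trans ((mW x).1 hx).2.1.le) (by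
      intro T hT hTne
      by_contra hcon
      push Not at hcon
      have hTS : T ⊆ S := fun x hx => ((mW x).1 (hT hx)).1
      have := hI T hTS hTne (closed_of_two (fun x hx => ((mW x).1 (hT hx)).2.1) hcon)
      have h1 := ((mW x0).1 (hT (this ▸ hx0S))).2.1
      omega)
  have degW : ∀ w ∈ W, (nb H w ∩ W).card + (nb H w ∩ B).card = 2 := by
    intro w hw
    rw [← ((mW w).1 hw).2.1, ← Finset.card_union_of_disjoint]
    · congr 1
      ext z
      simp only [Finset.mem_union, Finset.mem_inter, mem_nb]
      have := nW w hw z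
      tauto
    · rw [Finset.disjoint_left]
      intro z hz hz'
      exact BW z (Finset.mem_inter.1 hz').2 (Finset.mem_inter.1 hz).2
  have degB : ∀ b ∈ B, (nb H b ∩ W).card + (nb H b ∩ A).card = (nb H b).card := by
    intro b hb
    rw [← Finset.card_union_of_disjoint]
    · congr 1
      ext z
      simp only [Finset.mem_union, Finset.mem_inter, mem_nb]
      have := nB b hb z
      tauto
    · rw [Finset.disjoint_left]
      intro z hz hz'
      exact AW z (Finset.mem_inter.1 hz').2 (Finset.mem_inter.1 hz).2
  have hphi : phi H W + ∑ w ∈ W, (nb H w ∩ B).card = 2 * W.card := by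
    unfold phi
    rw [← Finset.sum_add_distrib, Finset.sum_congr rfl degW]
    simp [mul_comm]
  -- bad vertices
  obtain ⟨Bad, hBad⟩ : ∃ Bad, Bad = B.filter (fun b => (nb H b).card = 3 ∧
    ∀ w ∈ nb H b, w ∈ W ∧ (nb H w ∩ B).card = 2) := ⟨_, rfl⟩
  have mBad : ∀ b, b ∈ Bad ↔ b ∈ B ∧ (nb H b).card = 3 ∧
    ∀ w ∈ nb H b, w ∈ W ∧ (nb H w ∩ B).card = 2 := by intro b; rw [hBad]; simp
  obtain ⟨I, hIB, hIind, hImax⟩ := exists_max_indep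
    (fun b b' => ∃ w, H.Adj b w ∧ H.Adj b' w) (fun _ _ ⟨w, h1, h2⟩ => ⟨w, h2, h1⟩) Bad
  have cardBad : Bad.card ≤ I.card * 6 := by
    have hsub : Bad ⊆ I.biUnion (fun i => (nb H i).biUnion (fun w => nb H w ∩ B)) := by
      intro b hb
      have hbB := ((mBad b).1 hb).1
      simp only [Finset.mem_biUnion, Finset.mem_inter, mem_nb]
      rcases hImax b hb with h | ⟨i, hi, w, h1, h2⟩
      · obtain ⟨w, hw⟩ : (nb H b).Nonempty :=
          Finset.card_pos.1 (by have := hM.mindeg b; omega)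
        exact ⟨b, h, w, mem_nb.1 hw, (mem_nb.1 hw).symm, hbB⟩
      · exact ⟨i, hi, w, h1, h2.symm, hbB⟩
    refine (Finset.card_le_card hsub).trans (Finset.card_biUnion_le_card_mul _ _ _ ?_)
    intro i hi
    obtain ⟨_, h3, hw⟩ := (mBad i).1 (hIB hi)
    refine (Finset.card_biUnion_le_card_mul _ _ 2 (fun w hww => (hw w hww).2.le)).trans ?_
    omega
  have hIsub : I ⊆ B := fun i hi => ((mBad i).1 (hIB hi)).1
  -- discharging
  let g : V → ℕ := fun w => if (nb H w ∩ B).card = 2 then 13 else 15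
  have g13 : ∀ w, 13 ≤ g w := by intro w; dsimp only [g]; split_ifs <;> omega
  have charge : ∀ b ∈ B, 40 ≤ ∑ w ∈ nb H b ∩ W, g w + 20 * (nb H b ∩ A).card +
      (if b ∈ Bad then 1 else 0) := by
    intro b hb
    have hlow : (nb H b ∩ W).card * 13 ≤ ∑ w ∈ nb H b ∩ W, g w := by
      have := Finset.card_nsmul_le_sum (nb H b ∩ W) g 13 (fun w _ => g13 w)
      simpa using this
    have h3 := ((mB b).1 hb).2.1
    have hd := degB b hb
    by_cases hbad : b ∈ Bad
    · rw [if_pos hbad]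
      omega
    rw [if_neg hbad]
    by_cases hA0 : (nb H b ∩ A).card = 0
    swap
    · omega
    by_cases h4 : 4 ≤ (nb H b).card
    · omega
    have hc3 : (nb H b).card = 3 := by omega
    have hall : ∀ w ∈ nb H b, w ∈ W := by
      intro w hw
      rcases nB b hb w (mem_nb.1 hw) with h | h
      · exact h
      · have : w ∈ nb H b ∩ A := Finset.mem_inter.2 ⟨hw, h⟩
        rw [Finset.card_eq_zero.1 hA0] at this
        simp at this
    have : ∃ w ∈ nb H b, (nb H w ∩ B).card ≠ 2 := by
      by_contra hcon
      push Not at hcon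
      exact hbad ((mBad b).2 ⟨hb, hc3, fun w hw => ⟨hall w hw, hcon w hw⟩⟩)
    obtain ⟨w, hw, hw2⟩ := this
    have hwm : w ∈ nb H b ∩ W := Finset.mem_inter.2 ⟨hw, hall w hw⟩
    rw [← Finset.add_sum_erase _ _ hwm]
    have gw : g w = 15 := by simp [g, hw2]
    have hlow2 : ((nb H b ∩ W).erase w).card * 13 ≤ ∑ w ∈ (nb H b ∩ W).erase w, g w := by
      have := Finset.card_nsmul_le_sum ((nb H b ∩ W).erase w) g 13 (fun w _ => g13 w)
      simpa using this
    rw [Finset.card_erase_of_mem hwm] at hlow2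
    omega
  have total : 40 * B.card ≤ ∑ b ∈ B, ∑ w ∈ nb H b ∩ W, g w
      + 20 * ∑ b ∈ B, (nb H b ∩ A).card + Bad.card := by
    have h1 := Finset.sum_le_sum charge
    rw [Finset.sum_add_distrib, Finset.sum_add_distrib, ← Finset.mul_sum,
      ← Finset.sum_filter] at h1
    have h2 : (B.filter (· ∈ Bad)).card ≤ Bad.card :=
      Finset.card_le_card (fun x hx => (Finset.mem_filter.1 hx).2)
    simp only [Finset.sum_const, smul_eq_mul] at h1
    omega
  have sw1 : ∑ b ∈ B, ∑ w ∈ nb H b ∩ W, g w ≤ 4 * W.card + 11 * ∑ w ∈ W, (nb H w ∩ B).card := by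
    have e : ∑ b ∈ B, ∑ w ∈ nb H b ∩ W, g w = ∑ w ∈ W, ∑ b ∈ nb H w ∩ B, g w := by
      apply Finset.sum_comm'
      intro b w
      simp only [Finset.mem_inter, mem_nb]
      have := H.adj_comm b w
      tauto
    rw [e, Finset.mul_sum]
    have : ∑ w ∈ W, ∑ b ∈ nb H w ∩ B, g w ≤ ∑ w ∈ W, (4 + 11 * (nb H w ∩ B).card) := by
      apply Finset.sum_le_sum
      intro w hw
      have hd := degW w hw
      rw [Finset.sum_const, smul_eq_mul]
      have hle : (nb H w ∩ B).card ≤ 2 := by omega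
      dsimp only [g]
      generalize (nb H w ∩ B).card = k at hle
      interval_cases k <;> simp
    refine this.trans ?_
    rw [Finset.sum_add_distrib, Finset.sum_const, smul_eq_mul]
    omega
  have sw2 : ∑ b ∈ B, (nb H b ∩ A).card ≤ A.card := by
    have e : ∑ b ∈ B, (nb H b ∩ A).card = ∑ a ∈ A, (nb H a ∩ B).card := by
      simp only [Finset.card_eq_sum_ones]
      apply Finset.sum_comm'
      intro b a
      simp only [Finset.mem_inter, mem_nb]
      have := H.adj_comm b a
      tauto
    rw [e, Finset.card_eq_sum_ones A]
    apply Finset.sum_le_sum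
    intro a ha
    rw [← Finset.card_singleton (y a)]
    apply Finset.card_le_card
    intro z hz
    obtain ⟨hz1, hz2⟩ := Finset.mem_inter.1 hz
    rcases hQcl a ha a (haQ a ha) z (mem_nb.1 hz1) with h | h
    · exact absurd ((mU z).2 ⟨a, ha, h⟩) (BU z hz2)
    · simp [h.2]
  -- vertex count
  have cardU : U.card = 5 * A.card := by
    rw [hUdef, Finset.card_biUnion]
    · rw [Finset.sum_congr rfl (fun a ha => (hP a ha).1)]
      simp [mul_comm]
    · intro a ha b hb hab
      have ha : a ∈ A := ha
      have hb : b ∈ A := hb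
      change Disjoint (Q a) (Q b)
      rw [Finset.disjoint_iff_inter_eq_empty, ← Finset.not_nonempty_iff_eq_empty]
      intro hne
      have hbQ : b ∉ Q a := by
        intro h
        have := hQ2 a ha b h hab.symm
        have := hA3 b hb
        omega
      have haQb : a ∉ Q b := by
        intro h
        have := hQ2 b hb a h hab
        have := hA3 a ha
        omega
      have hcl : ClosedS H (Q a ∩ Q b) := by
        intro x hx z hz
        obtain ⟨hx1, hx2⟩ := Finset.mem_inter.1 hx
        refine Finset.mem_inter.2 ⟨?_, ?_⟩
        · rcases hQcl a ha x hx1 z hz with h | h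
          · exact h
          · exact absurd (h.1 ▸ hx2) haQb
        · rcases hQcl b hb x hx2 z hz with h | h
          · exact h
          · exact absurd (h.1 ▸ hx1) hbQ
      have := hI _ (Finset.inter_subset_left.trans (hQS a ha)) hne hcl
      have h1 : a ∈ Q a ∩ Q b := this ▸ hAS a ha
      exact haQb (Finset.mem_inter.1 h1).2
  have cardS : B.card + W.card + U.card ≤ S.card := by
    rw [← Finset.card_union_of_disjoint (Finset.disjoint_left.2 BW),
      ← Finset.card_union_of_disjoint]
    · apply Finset.card_le_card
      intro x hx
      rcases Finset.mem_union.1 hx with hx | hx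
      · rcases Finset.mem_union.1 hx with hx | hx
        · exact ((mB x).1 hx).1
        · exact ((mW x).1 hx).1
      · obtain ⟨a, ha, h⟩ := (mU x).1 hx
        exact hQS a ha h
    · rw [Finset.disjoint_left]
      intro x hx
      rcases Finset.mem_union.1 hx with hx | hx
      · exact BU x hx
      · exact ((mW x).1 hx).2.2
  -- the function
  refine good_of_DR ((B \ I) ∪ (DW ∪ A.image dd)) (I ∪ (RW ∪ A.image ee)) ?_ ?_
  · intro v hv
    by_cases hvU : v ∈ U
    · obtain ⟨a, ha, hvQ⟩ := (mU v).1 hvU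
      rcases hde a ha v hvQ with h | h | h | h
      · right; right
        refine ⟨y a, ?_, h ▸ hay a ha⟩
        apply Finset.mem_union_left
        refine Finset.mem_sdiff.2 ⟨hyB a ha, fun hyI => ?_⟩
        have := (((mBad _).1 (hIB hyI)).2.2 a (mem_nb.2 (hay a ha).symm)).1
        exact AW a ha this
      · left
        exact Finset.mem_union_right _ (Finset.mem_union_right _
          (h ▸ Finset.mem_image_of_mem dd ha))
      · right; left
        exact Finset.mem_union_right _ (Finset.mem_union_right _
          (h ▸ Finset.mem_image_of_mem ee ha))
      · right; right
        exact ⟨dd a, Finset.mem_union_right _ (Finset.mem_union_right _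
          (Finset.mem_image_of_mem dd ha)), h⟩
    by_cases hv3 : 3 ≤ (nb H v).card
    · have hvB : v ∈ B := (mB v).2 ⟨hv, hv3, fun h => hvU ((mU v).2 ⟨v, h, haQ v h⟩)⟩
      by_cases hvI : v ∈ I
      · exact Or.inr (Or.inl (Finset.mem_union_left _ hvI))
      · exact Or.inl (Finset.mem_union_left _ (Finset.mem_sdiff.2 ⟨hvB, hvI⟩))
    have hvW : v ∈ W := (mW v).2 ⟨hv, by have := hM.mindeg v; omega, hvU⟩
    by_cases hw2 : (nb H v ∩ W).card = 2
    · rcases hdomW v hvW hw2 with h | h | ⟨z, h, h'⟩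
      · exact Or.inl (Finset.mem_union_right _ (Finset.mem_union_left _ h))
      · exact Or.inr (Or.inl (Finset.mem_union_right _ (Finset.mem_union_left _ h)))
      · exact Or.inr (Or.inr
          ⟨z, Finset.mem_union_right _ (Finset.mem_union_left _ h), h'⟩)
    right; right
    have hd := degW v hvW
    obtain ⟨b, hb⟩ : (nb H v ∩ B).Nonempty := Finset.card_pos.1 (by omega)
    obtain ⟨hb1, hbB⟩ := Finset.mem_inter.1 hb
    by_cases hbI : b ∈ I
    · have h2 := (((mBad b).1 (hIB hbI)).2.2 v (mem_nb.2 (mem_nb.1 hb1).symm)).2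
      obtain ⟨b', hb', hne⟩ := Finset.exists_mem_ne (by omega : 1 < (nb H v ∩ B).card) b
      obtain ⟨hb'1, hb'B⟩ := Finset.mem_inter.1 hb'
      refine ⟨b', Finset.mem_union_left _ (Finset.mem_sdiff.2 ⟨hb'B, fun h => ?_⟩), mem_nb.1 hb'1⟩
      exact hIind b' h b hbI hne ⟨v, (mem_nb.1 hb'1).symm, (mem_nb.1 hb1).symm⟩
    · exact ⟨b, Finset.mem_union_left _ (Finset.mem_sdiff.2 ⟨hbB, hbI⟩), mem_nb.1 hb1⟩
  · have k1 := Finset.card_union_le (B \ I) (DW ∪ A.image dd)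
    have k2 := Finset.card_union_le DW (A.image dd)
    have k3 := Finset.card_union_le I (RW ∪ A.image ee)
    have k4 := Finset.card_union_le RW (A.image ee)
    have k5 : (A.image dd).card ≤ A.card := Finset.card_image_le
    have k6 : (A.image ee).card ≤ A.card := Finset.card_image_le
    have k7 := Finset.card_sdiff_add_card_eq_card hIsub
    omega

theorem good_closed {H : SimpleGraph V} (hM : MinG H) : ∀ (n : ℕ) (S : Finset V), S.card = n →
    ClosedS H S → GoodS H S := by
  intro n
  induction n using Nat.strong_induction_on with
  | _ n ih =>
  intro S hn hS
  by_cases hne : S.Nonempty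
  swap
  · rw [Finset.not_nonempty_iff_eq_empty] at hne
    subst hne
    exact ⟨fun _ => 0, by simp, by simp⟩
  by_cases hI : Irred H S
  · by_cases hbig : ∃ x ∈ S, 3 ≤ (nb H x).card
    · exact good_main hM hS hI hbig
    · push Not at hbig
      refine good_cycle hM hS hI hne (fun x hx => ?_)
      have := hbig x hx
      have := hM.mindeg x
      omega
  · unfold Irred at hI
    push Not at hI
    obtain ⟨T, hTS, hTne, hT, hTS'⟩ := hI
    have hlt : T.card < S.card := Finset.card_lt_card (hTS.ssubset_of_ne hTS')
    have hpos : 0 < T.card := Finset.card_pos.2 hTne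
    have hc := Finset.card_sdiff_add_card_eq_card hTS
    refine good_glue hTS hT (ih _ (by omega) T rfl hT) (ih _ (by omega) (S \ T) rfl ?_)
    intro x hx z hz
    obtain ⟨h1, h2⟩ := Finset.mem_sdiff.1 hx
    exact Finset.mem_sdiff.2 ⟨hS x h1 z hz, fun h => h2 (hT z h x hz.symm)⟩

theorem five_labels {G : SimpleGraph V} {S : Finset V} (h5 : S.card = 5) (hS : ClosedS G S)
    (h2 : ∀ x ∈ S, (nb G x).card = 2) :
    ∃ a b c d e : V, S = {a, b, c, d, e} ∧ G.Adj a b ∧ G.Adj b c ∧ G.Adj c d ∧ G.Adj d e ∧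
      G.Adj e a := by
  obtain ⟨a, ha⟩ : S.Nonempty := Finset.card_pos.1 (by omega)
  have two : ∀ x ∈ S, ∃ u v, u ≠ v ∧ ∀ z, G.Adj x z ↔ z = u ∨ z = v := by
    intro x hx
    obtain ⟨u, v, huv, h⟩ := Finset.card_eq_two.1 (h2 x hx)
    refine ⟨u, v, huv, fun z => ?_⟩
    rw [← mem_nb, h]; simp
  obtain ⟨b, e, hbe, hNa⟩ := two a ha
  have hab : G.Adj a b := (hNa b).2 (Or.inl rfl)
  have hae : G.Adj a e := (hNa e).2 (Or.inr rfl)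
  have hb := hS a ha b hab
  have he := hS a ha e hae
  have hsub : ({a, b, e} : Finset V) ⊆ S := by
    intro x hx
    simp only [Finset.mem_insert, Finset.mem_singleton] at hx
    rcases hx with rfl | rfl | rfl <;> assumption
  have hc3 : ({a, b, e} : Finset V).card = 3 := Finset.card_eq_three.2
    ⟨a, b, e, hab.ne, hae.ne, hbe, rfl⟩
  have hcc := Finset.card_sdiff_add_card_eq_card hsub
  obtain ⟨c, d, hcd, hs⟩ := Finset.card_eq_two.1
    (show (S \ {a, b, e}).card = 2 by omega)
  have hcm : c ∈ S \ {a, b, e} := by rw [hs]; simp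
  have hdm : d ∈ S \ {a, b, e} := by rw [hs]; simp
  simp only [Finset.mem_sdiff, Finset.mem_insert, Finset.mem_singleton, not_or] at hcm hdm
  obtain ⟨hc, hca, hcb, hce⟩ := hcm
  obtain ⟨hd, hda, hdb, hde⟩ := hdm
  have cov : ∀ x, x ∈ S ↔ x = a ∨ x = b ∨ x = c ∨ x = d ∨ x = e := by
    intro x
    constructor
    · intro hx
      by_cases h : x ∈ ({a, b, e} : Finset V)
      · simp only [Finset.mem_insert, Finset.mem_singleton] at h
        tauto
      · have : x ∈ S \ {a, b, e} := Finset.mem_sdiff.2 ⟨hx, h⟩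
        rw [hs] at this
        simp only [Finset.mem_insert, Finset.mem_singleton] at this
        tauto
    · rintro (rfl | rfl | rfl | rfl | rfl) <;> assumption
  have nbcov : ∀ x ∈ S, ∀ z, G.Adj x z → z = a ∨ z = b ∨ z = c ∨ z = d ∨ z = e :=
    fun x hx z hz => (cov z).1 (hS x hx z hz)
  have irr : ∀ x, ¬ G.Adj x x := fun x => G.loopless.irrefl x
  have sym : ∀ x z, G.Adj x z → G.Adj z x := fun x z h => h.symm
  obtain ⟨b1, b2, hb12, hNb⟩ := two b hb
  obtain ⟨c1, c2, hc12, hNc⟩ := two c hc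
  obtain ⟨d1, d2, hd12, hNd⟩ := two d hd
  obtain ⟨e1, e2, he12, hNe⟩ := two e he
  have nac : ¬ G.Adj a c := fun h => by rcases (hNa c).1 h with h | h <;> tauto
  have nad : ¬ G.Adj a d := fun h => by rcases (hNa d).1 h with h | h <;> tauto
  have three : ∀ x ∈ S, ∀ u v w, G.Adj x u → G.Adj x v → G.Adj x w → u = v ∨ u = w ∨ v = w := by
    intro x hx u v w h1 h2 h3
    obtain ⟨p, q, _, hpq⟩ := two x hx
    have := (hpq u).1 h1
    have := (hpq v).1 h2
    have := (hpq w).1 h3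
    grind
  have sel : ∀ x ∈ S, ∀ t, ∃ z, z ≠ t ∧ G.Adj x z := by
    intro x hx t
    obtain ⟨p, q, hne, hpq⟩ := two x hx
    by_cases h : p = t
    · exact ⟨q, fun hq => hne (h.trans hq.symm), (hpq q).2 (Or.inr rfl)⟩
    · exact ⟨p, h, (hpq p).2 (Or.inl rfl)⟩
  have nbe : ¬ G.Adj b e := by
    intro h
    obtain ⟨z, hz, hcz⟩ := sel c hc d
    rcases nbcov c hc z hcz with rfl | rfl | rfl | rfl | rfl
    · exact nac hcz.symm
    · rcases three z hb a e c hab.symm h hcz.symm with h | h | h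
      · exact hae.ne h
      · exact hca h.symm
      · exact hce h.symm
    · exact irr _ hcz
    · exact hz rfl
    · rcases three z he a b c hae.symm h.symm hcz.symm with h | h | h
      · exact hab.ne h
      · exact hca h.symm
      · exact hcb h.symm
  have key : ∀ c d, c ∈ S → d ∈ S → c ≠ d → c ≠ a → c ≠ b → c ≠ e → d ≠ a → d ≠ b → d ≠ e →
      (∀ x ∈ S, x = a ∨ x = b ∨ x = c ∨ x = d ∨ x = e) → ¬ G.Adj a c → ¬ G.Adj a d →
      G.Adj b c → G.Adj c d ∧ G.Adj d e := by
    intro c d hc hd hcd hca hcb hce hda hdb hde cov nac nad hbc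
    have nbd : ¬ G.Adj b d := by
      intro h
      rcases three b hb a c d hab.symm hbc h with h | h | h
      · exact hca h.symm
      · exact hda h.symm
      · exact hcd h
    have hde' : G.Adj d e := by
      obtain ⟨z, hz, hdz⟩ := sel d hd c
      rcases cov z (hS d hd z hdz) with rfl | rfl | rfl | rfl | rfl
      · exact absurd hdz.symm nad
      · exact absurd hdz.symm nbd
      · exact absurd rfl hz
      · exact absurd hdz (irr _)
      · exact hdz
    refine ⟨?_, hde'⟩
    obtain ⟨z, hz, hdz⟩ := sel d hd e
    rcases cov z (hS d hd z hdz) with rfl | rfl | rfl | rfl | rfl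
    · exact absurd hdz.symm nad
    · exact absurd hdz.symm nbd
    · exact hdz.symm
    · exact absurd hdz (irr _)
    · exact absurd rfl hz
  obtain ⟨z, hz, hbz⟩ := sel b hb a
  rcases nbcov b hb z hbz with rfl | rfl | rfl | rfl | rfl
  · exact absurd rfl hz
  · exact absurd hbz (irr _)
  · obtain ⟨k1, k2⟩ := key z d hc hd hcd hca hcb hce hda hdb hde
      (fun x hx => (cov x).1 hx) nac nad hbz
    refine ⟨a, b, z, d, e, ?_, hab, hbz, k1, k2, hae.symm⟩
    ext x; rw [cov]; simp
  · obtain ⟨k1, k2⟩ := key z c hd hc hcd.symm hda hdb hde hca hcb hce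
      (fun x hx => by rcases (cov x).1 hx with h | h | h | h | h <;> simp [h]) nad nac hbz
    refine ⟨a, b, z, c, e, ?_, hab, hbz, k1, k2, hae.symm⟩
    ext x; rw [cov]; simp; tauto
  · exact absurd hbz nbe

theorem noC5_of {G : SimpleGraph V}
    (hC5 : ∀ c : G.ConnectedComponent, ¬ Nonempty (G.induce c.supp ≃g cycleG 5)) :
    ∀ S : Finset V, S.card = 5 → ClosedS G S → ∃ x ∈ S, (nb G x).card ≠ 2 := by
  intro S h5 hS
  by_contra hcon
  push Not at hcon
  obtain ⟨a, b, c, d, e, hSe, hab, hbc, hcd, hde, hea⟩ := five_labels h5 hS hcon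
  have ms : ∀ x, x ∈ S ↔ x = a ∨ x = b ∨ x = c ∨ x = d ∨ x = e := by
    intro x; rw [hSe]; simp
  -- injectivity
  let p : Fin 5 → V := ![a, b, c, d, e]
  have himg : Finset.univ.image p = S := by
    ext x
    rw [ms]
    simp [p, Fin.exists_fin_succ, eq_comm]
  have hinj : Function.Injective p := by
    have : (Finset.univ.image p).card = (Finset.univ : Finset (Fin 5)).card := by
      rw [himg, h5]; simp
    have := Finset.injOn_of_card_image_eq this
    intro i j hij
    exact this (by simp) (by simp) hij
  have pS : ∀ i, p i ∈ S := fun i => himg ▸ Finset.mem_image_of_mem p (Finset.mem_univ i)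
  have hcyc : ∀ i : Fin 5, G.Adj (p i) (p (i + 1)) := by
    intro i
    fin_cases i
    · exact hab
    · exact hbc
    · exact hcd
    · exact hde
    · exact hea
  have hcyc' : ∀ i : Fin 5, G.Adj (p i) (p (i - 1)) := by
    intro i
    have := (hcyc (i - 1)).symm
    rwa [sub_add_cancel] at this
  have dec1 : ∀ i : Fin 5, i + 1 ≠ i - 1 := by decide
  have hnb : ∀ i : Fin 5, nb G (p i) = {p (i + 1), p (i - 1)} := by
    intro i
    symm
    apply Finset.eq_of_subset_of_card_le
    · intro z hz
      simp only [Finset.mem_insert, Finset.mem_singleton] at hz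
      rcases hz with rfl | rfl
      · exact mem_nb.2 (hcyc i)
      · exact mem_nb.2 (hcyc' i)
    · rw [hcon _ (pS i), Finset.card_pair (fun h => dec1 i (hinj h))]
  have dec2 : ∀ i j : Fin 5, (cycleG 5).Adj i j ↔ (j = i + 1 ∨ j = i - 1) := by
    intro i j
    simp only [cycleG, SimpleGraph.fromRel_adj]
    revert i j
    decide
  have hadj : ∀ i j : Fin 5, G.Adj (p i) (p j) ↔ (cycleG 5).Adj i j := by
    intro i j
    rw [dec2, ← mem_nb, hnb]
    simp [hinj.eq_iff]
  have hreach : ∀ u v, G.Reachable u v → u ∈ S → v ∈ S := by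
    rintro u v ⟨w⟩
    induction w with
    | nil => exact id
    | cons h _ ih => exact fun hu => ih (hS _ hu _ h)
  have hsupp : ∀ x, x ∈ (G.connectedComponentMk a).supp ↔ x ∈ S := by
    intro x
    rw [SimpleGraph.ConnectedComponent.mem_supp_iff, SimpleGraph.ConnectedComponent.eq]
    constructor
    · intro h
      exact hreach a x h.symm ((ms a).2 (Or.inl rfl))
    · intro hx
      have r1 : G.Reachable b a := hab.symm.reachable
      have r2 : G.Reachable c a := hbc.symm.reachable.trans r1
      have r3 : G.Reachable d a := hcd.symm.reachable.trans r2
      have r4 : G.Reachable e a := hea.reachable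
      rcases (ms x).1 hx with rfl | rfl | rfl | rfl | rfl
      · exact SimpleGraph.Reachable.refl _
      · exact r1
      · exact r2
      · exact r3
      · exact r4
  apply hC5 (G.connectedComponentMk a)
  let q : Fin 5 → (G.connectedComponentMk a).supp := fun i => ⟨p i, (hsupp _).2 (pS i)⟩
  have hq : Function.Bijective q := by
    constructor
    · intro i j hij
      exact hinj (congrArg Subtype.val hij)
    · rintro ⟨x, hx⟩
      have hx' := (hsupp x).1 hx
      rw [← himg] at hx'
      obtain ⟨i, _, hi⟩ := Finset.mem_image.1 hx'
      exact ⟨i, Subtype.ext hi⟩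
  let iso : cycleG 5 ≃g G.induce (G.connectedComponentMk a).supp :=
    { toEquiv := Equiv.ofBijective q hq
      map_rel_iff' := by
        intro i j
        exact hadj i j }
  exact ⟨iso.symm⟩

theorem exists_minG {G : SimpleGraph V} (hdeg : ∀ x, 2 ≤ (nb G x).card)
    (hno : ∀ S : Finset V, S.card = 5 → ClosedS G S → ∃ x ∈ S, (nb G x).card ≠ 2) :
    ∃ H ≤ G, MinG H := by
  obtain ⟨H, hHG, hmin⟩ := exists_minimal_le_of_wellFoundedLT
    (fun H : SimpleGraph V => (∀ x, 2 ≤ (nb H x).card) ∧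
      ∀ S : Finset V, S.card = 5 → ClosedS H S → ∃ x ∈ S, (nb H x).card ≠ 2) G ⟨hdeg, hno⟩
  refine ⟨H, hHG, hmin.prop.1, hmin.prop.2, ?_⟩
  intro u v huv hu hv
  have hadj : ∀ x z, (H.deleteEdges {s(u, v)}).Adj x z ↔
      H.Adj x z ∧ ¬ ((x = u ∧ z = v) ∨ (x = v ∧ z = u)) := by
    intro x z
    rw [SimpleGraph.deleteEdges_adj]
    simp
  have nbu : nb (H.deleteEdges {s(u, v)}) u = (nb H u).erase v := by
    ext z
    rw [mem_nb, hadj, Finset.mem_erase, mem_nb]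
    have := huv.ne
    tauto
  have nbv : nb (H.deleteEdges {s(u, v)}) v = (nb H v).erase u := by
    ext z
    rw [mem_nb, hadj, Finset.mem_erase, mem_nb]
    have := huv.ne.symm
    tauto
  have nbx : ∀ x, x ≠ u → x ≠ v → nb (H.deleteEdges {s(u, v)}) x = nb H x := by
    intro x h1 h2
    ext z
    rw [mem_nb, hadj, mem_nb]
    tauto
  have cu : (nb (H.deleteEdges {s(u, v)}) u).card = (nb H u).card - 1 := by
    rw [nbu, Finset.card_erase_of_mem (mem_nb.2 huv)]
  have cv : (nb (H.deleteEdges {s(u, v)}) v).card = (nb H v).card - 1 := by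
    rw [nbv, Finset.card_erase_of_mem (mem_nb.2 huv.symm)]
  have hle : H.deleteEdges {s(u, v)} ≤ H := SimpleGraph.deleteEdges_le _
  have hnot : ¬ H ≤ H.deleteEdges {s(u, v)} := by
    intro h
    have := (hadj u v).1 (h huv)
    tauto
  have hfail : ¬ ∀ S : Finset V, S.card = 5 → ClosedS (H.deleteEdges {s(u, v)}) S →
      ∃ x ∈ S, (nb (H.deleteEdges {s(u, v)}) x).card ≠ 2 := by
    intro hall
    refine hnot (hmin.le_of_le ⟨?_, hall⟩ hle)
    intro x
    by_cases h1 : x = u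
    · subst h1; omega
    by_cases h2 : x = v
    · subst h2; omega
    rw [nbx x h1 h2]
    exact hmin.prop.1 x
  push Not at hfail
  obtain ⟨S, hS5, hScl, hS2⟩ := hfail
  refine ⟨S, ?_⟩
  have cl : ∀ x ∈ S, ∀ z, H.Adj x z → z ∈ S ∨ (x = u ∧ z = v) ∨ (x = v ∧ z = u) := by
    intro x hx z hz
    by_cases h : (x = u ∧ z = v) ∨ (x = v ∧ z = u)
    · exact Or.inr h
    · exact Or.inl (hScl x hx z ((hadj x z).2 ⟨hz, h⟩))
  have d2 : ∀ x ∈ S, x ≠ u → x ≠ v → (nb H x).card = 2 := by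
    intro x hx h1 h2
    rw [← nbx x h1 h2]
    exact hS2 x hx
  by_cases huS : u ∈ S
  · left
    refine ⟨hS5, huS, huv, ?_, d2, ?_, hv⟩
    · intro x hx z hz
      rcases cl x hx z hz with h | h | h
      · exact Or.inl h
      · exact Or.inr h
      · exact Or.inl (h.2 ▸ huS)
    · have := hS2 u huS
      omega
  by_cases hvS : v ∈ S
  · right
    refine ⟨hS5, hvS, huv.symm, ?_, fun x hx h1 h2 => d2 x hx h2 h1, ?_, hu⟩
    · intro x hx z hz
      rcases cl x hx z hz with h | h | h
      · exact Or.inl h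
      · exact Or.inl (h.2 ▸ hvS)
      · exact Or.inr h
    · have := hS2 v hvS
      omega
  exfalso
  obtain ⟨x, hx, hx2⟩ := hmin.prop.2 S hS5 (by
    intro x hx z hz
    rcases cl x hx z hz with h | h | h
    · exact h
    · exact absurd (h.1 ▸ hx) huS
    · exact absurd (h.1 ▸ hx) hvS)
  exact hx2 (d2 x hx (fun h => huS (h ▸ hx)) (fun h => hvS (h ▸ hx)))

end DRDHelpers

/-- Let `G` be a graph of order `n ≥ 5` with minimum degree at least `2` and with no
component isomorphic to `C_5`.  Then `γ_dR(G) ≤ ⌊13n/11⌋`. -/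
theorem gammaDR_le_thirteen_elevenths {V : Type} [Fintype V] (G : SimpleGraph V)
    (hn : 5 ≤ Fintype.card V)
    (hdeg : ∀ v, 2 ≤ {w | G.Adj v w}.ncard)
    (hC5 : ∀ c : G.ConnectedComponent, ¬ Nonempty (G.induce c.supp ≃g cycleG 5)) :
    gammaDR G ≤ 13 * Fintype.card V / 11 := by
  have hd : ∀ x, 2 ≤ (nb G x).card := by
    intro x
    have h := hdeg x
    have e : {w | G.Adj x w} = ((nb G x : Finset V) : Set V) := by
      ext w
      simp [mem_nb]
    rwa [e, Set.ncard_coe_finset] at h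
  obtain ⟨H, hHG, hM⟩ := exists_minG hd (noC5_of hC5)
  obtain ⟨f, hf, hw⟩ := good_closed hM _ Finset.univ rfl (fun x _ y _ => Finset.mem_univ y)
  have hdr : IsDRDF G f := by
    refine ⟨fun v => (hf v (Finset.mem_univ v)).1, fun v h0 => ?_, fun v h1 => ?_⟩
    · rcases (hf v (Finset.mem_univ v)).2.1 h0 with ⟨u, w, h1, h2, h3, h4, h5⟩ | ⟨u, h1, h2⟩
      · exact Or.inl ⟨u, w, h1, hHG h2, hHG h3, h4, h5⟩
      · exact Or.inr ⟨u, hHG h1, h2⟩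
    · obtain ⟨u, h1, h2⟩ := (hf v (Finset.mem_univ v)).2.2 h1
      exact ⟨u, hHG h1, h2⟩
  have hle : gammaDR G ≤ ∑ v, f v := Nat.sInf_le ⟨f, hdr, rfl⟩
  rw [Finset.card_univ] at hw
  rw [Nat.le_div_iff_mul_le (by norm_num)]
  omega
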